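/- Let G be a finite group in which |ab| = |a||b| whenever a and b are commutators of coprime orders. Then the derived subgroup G' is nilpotent. -/

import Mathlib

section Preliminaries

open Subgroup
open scoped commutatorElement

/-- An element of a `p`-subgroup `P` of the form `⁅a, u⁆` with `a ∈ P` and `u` arbitrary. -/
def IsFocal {G : Type*} [Group G] (p : ℕ) (x : G) : Prop :=
  ∃ P : Subgroup G, IsPGroup p P ∧ x ∈ P ∧ ∃ a ∈ P, ∃ u : G, x = ⁅a, u⁆

/-- Every proper subgroup `M` contains its focal `p`-elements in a normal `p`-subgroup of `M`. -/
def HasFocalCores (G : Type*) [Group G] : Prop :=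
  ∀ M : Subgroup G, M ≠ ⊤ → ∀ p : ℕ, p.Prime → ∀ x ∈ M, IsFocal p x →
    ∃ K : Subgroup G, IsPGroup p K ∧ K ≤ M ∧ M ≤ normalizer (K : Set G) ∧ x ∈ K

section General

variable {G : Type*} [Group G] {p : ℕ}

theorem IsFocal.map {H : Type*} [Group H] {x : G} (hx : IsFocal p x) (f : G →* H) :
    IsFocal p (f x) := by
  obtain ⟨P, hP, hxP, a, ha, u, rfl⟩ := hx
  exact ⟨P.map f, hP.map f, mem_map_of_mem f hxP, f a, mem_map_of_mem f ha, f u,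
    map_commutatorElement f a u⟩

theorem IsFocal.exists_pow_eq_one {x : G} (hx : IsFocal p x) : ∃ k, x ^ p ^ k = 1 := by
  obtain ⟨P, hP, hxP, -⟩ := hx
  obtain ⟨k, hk⟩ := hP ⟨x, hxP⟩
  exact ⟨k, by simpa using congrArg Subtype.val hk⟩

theorem IsPGroup.exists_pow_eq_one {P : Subgroup G} (hP : IsPGroup p P) {x : G} (hx : x ∈ P) :
    ∃ k, x ^ p ^ k = 1 := by
  obtain ⟨k, hk⟩ := hP ⟨x, hx⟩
  exact ⟨k, by simpa using congrArg Subtype.val hk⟩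

theorem isPGroup_zpowers {x : G} (hx : ∃ k, x ^ p ^ k = 1) : IsPGroup p (zpowers x) := by
  obtain ⟨k, hk⟩ := hx
  rintro ⟨y, n, rfl⟩
  refine ⟨k, Subtype.ext ?_⟩
  change (x ^ n) ^ p ^ k = 1
  rw [← zpow_natCast, ← zpow_mul, mul_comm, zpow_mul, zpow_natCast, hk, one_zpow]

/-- A `p`-element normalizing a Sylow `p`-subgroup lies in it. -/
theorem Sylow.mem_of_mem_normalizer (P : Sylow p G) {x : G} (hx : ∃ k, x ^ p ^ k = 1)
    (hn : x ∈ normalizer ((P : Subgroup G) : Set G)) : x ∈ (P : Subgroup G) := by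
  have h := (isPGroup_zpowers hx).inf_normalizer_sylow P
  have : x ∈ zpowers x ⊓ normalizer (P : Set G) := ⟨mem_zpowers x, hn⟩
  rw [h] at this
  exact this.2

theorem exists_sylow_mem {x : G} (hx : ∃ k, x ^ p ^ k = 1) :
    ∃ P : Sylow p G, x ∈ (P : Subgroup G) := by
  obtain ⟨P, hP⟩ := (isPGroup_zpowers hx).exists_le_sylow
  exact ⟨P, hP (mem_zpowers x)⟩

variable [Finite G]

theorem mem_normalizer_of_conj_mem {D : Subgroup G} {u : G} (h : ∀ d ∈ D, u * d * u⁻¹ ∈ D) :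
    u ∈ normalizer (D : Set G) :=
  mem_normalizer_fintype h

/-- Every element is the product of a `p`-element and an element of order coprime to `p`, both among
its powers. -/
theorem exists_pow_mul_pow_eq (g : G) (hp : p.Prime) :
    ∃ i j : ℕ, g = g ^ i * g ^ j ∧ (∃ k, (g ^ i) ^ p ^ k = 1) ∧ (orderOf (g ^ j)).Coprime p := by
  obtain ⟨a, m, hm, hn⟩ := Nat.exists_eq_pow_mul_and_not_dvd (orderOf_pos g).ne' p hp.ne_one
  have hcop : (p ^ a).Coprime m := Nat.Coprime.pow_left a ((Nat.Prime.coprime_iff_not_dvd hp).2 hm)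
  obtain ⟨i, hi1, hi2⟩ := Nat.chineseRemainder hcop 1 0
  obtain ⟨j, hj1, hj2⟩ := Nat.chineseRemainder hcop 0 1
  refine ⟨i, j, ?_, ⟨a, ?_⟩, ?_⟩
  · rw [← pow_add]
    conv_lhs => rw [← pow_one g]
    rw [pow_eq_pow_iff_modEq, hn, ← Nat.modEq_and_modEq_iff_modEq_mul hcop]
    exact ⟨(hi1.add hj1).symm, (hi2.add hj2).symm⟩
  · rw [← pow_mul, ← orderOf_dvd_iff_pow_eq_one, hn, mul_comm]
    exact Nat.mul_dvd_mul ((Nat.modEq_zero_iff_dvd).1 hi2) dvd_rfl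
  · have : orderOf (g ^ j) ∣ m := by
      rw [orderOf_dvd_iff_pow_eq_one, ← pow_mul, ← orderOf_dvd_iff_pow_eq_one, hn]
      exact Nat.mul_dvd_mul ((Nat.modEq_zero_iff_dvd).1 hj1) dvd_rfl
    exact Nat.Coprime.coprime_dvd_left this ((Nat.Prime.coprime_iff_not_dvd hp).2 hm).symm

theorem eq_top_of_forall_sylow_le {C : Subgroup G}
    (h : ∀ p : ℕ, p.Prime → ∃ P : Sylow p G, (P : Subgroup G) ≤ C) : C = ⊤ := by
  rw [← index_eq_one, Nat.eq_one_iff_not_exists_prime_dvd]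
  intro p hp hdvd
  have : Fact p.Prime := ⟨hp⟩
  obtain ⟨P, hP⟩ := h p hp
  exact P.not_dvd_index (hdvd.trans (index_dvd_of_le hP))

theorem eq_top_of_forall_primary_mem {C : Subgroup G}
    (h : ∀ p : ℕ, p.Prime → ∀ x : G, (∃ k, x ^ p ^ k = 1) → x ∈ C) : C = ⊤ :=
  eq_top_of_forall_sylow_le fun p hp ↦
    ⟨default, fun _ hx ↦ h p hp _ (IsPGroup.exists_pow_eq_one (Sylow.isPGroup' _) hx)⟩

/-- An element lies in every subgroup containing all its powers of prime power order. -/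
theorem mem_of_forall_primary_pow_mem {C : Subgroup G} (g : G)
    (h : ∀ p : ℕ, p.Prime → p ∣ orderOf g → ∀ x ∈ zpowers g, (∃ k, x ^ p ^ k = 1) → x ∈ C) :
    g ∈ C := by
  have key : C.subgroupOf (zpowers g) = ⊤ := by
    refine eq_top_of_forall_primary_mem fun p hp x ⟨k, hk⟩ ↦ ?_
    rw [mem_subgroupOf]
    by_cases hd : p ∣ orderOf g
    · exact h p hp hd x x.2 ⟨k, by simpa using congrArg Subtype.val hk⟩
    · have h1 : orderOf x ∣ p ^ k := orderOf_dvd_of_pow_eq_one hk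
      have h2 : orderOf x ∣ orderOf g := by
        rw [← Nat.card_zpowers g]; exact _root_.orderOf_dvd_natCard x
      have h3 : (p ^ k).Coprime (orderOf g) :=
        Nat.Coprime.pow_left k ((Nat.Prime.coprime_iff_not_dvd hp).2 hd)
      have h4 : x = 1 := orderOf_eq_one_iff.1 (Nat.eq_one_of_dvd_coprimes h3 h1 h2)
      rw [h4]; exact C.one_mem
  exact subgroupOf_eq_top.1 key (mem_zpowers g)

theorem IsPGroup.exists_mem_normalizer_of_lt (hp : p.Prime) {P D : Subgroup G}
    (hP : IsPGroup p P) (h : D < P) : ∃ u ∈ P, u ∉ D ∧ u ∈ normalizer (D : Set G) := by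
  have : Fact p.Prime := ⟨hp⟩
  have : Group.IsNilpotent P := hP.isNilpotent
  have hlt : D.subgroupOf P < ⊤ := by
    rw [lt_top_iff_ne_top, Ne, subgroupOf_eq_top]
    exact h.not_ge
  obtain ⟨u, hu, hu'⟩ := SetLike.exists_of_lt
    (Group.normalizerCondition_of_isNilpotent (D.subgroupOf P) hlt)
  refine ⟨u, u.2, hu', mem_normalizer_of_conj_mem fun d hd ↦ ?_⟩
  have := (mem_normalizer_iff.1 hu ⟨d, h.le hd⟩).1 hd
  simpa [mem_subgroupOf] using this

/-- Form of the focal subgroup theorem. -/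
theorem commutator_inf_sylow_le (hp : p.Prime) (P : Sylow p G) :
    commutator G ⊓ P ≤ closure {x : G | x ∈ (P : Subgroup G) ∧ IsFocal p x} := by
  have : Fact p.Prime := ⟨hp⟩
  rw [commutator_inf_eq_focalSubgroup, focalSubgroup_def]
  refine closure_mono ?_
  rintro x ⟨hx, a, ha, u, rfl⟩
  exact ⟨hx, P, P.isPGroup', hx, a, ha, u, rfl⟩

theorem exists_isFocal_of_dvd_card_commutator (hp : p.Prime) {K : Subgroup G}
    (h : p ∣ Nat.card (⁅K, K⁆ : Subgroup G)) : ∃ x ∈ K, x ≠ 1 ∧ IsFocal p x := by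
  have : Fact p.Prime := ⟨hp⟩
  obtain ⟨d, hd⟩ := exists_prime_orderOf_dvd_card' p h
  have hd' : (d : G) ∈ (commutator K).map K.subtype := by
    rw [K.map_subtype_commutator]; exact d.2
  obtain ⟨y, hy, hyd⟩ := hd'
  have hyo : orderOf y = p := by
    rw [← hd, ← orderOf_coe d, ← hyd]; exact (orderOf_coe y).symm
  obtain ⟨P, hP⟩ := exists_sylow_mem (p := p) (x := y)
    ⟨1, by rw [pow_one, ← hyo, pow_orderOf_eq_one]⟩
  have hmem := commutator_inf_sylow_le hp P ⟨hy, hP⟩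
  by_contra! hno
  have : closure {x : K | x ∈ (P : Subgroup K) ∧ IsFocal p x} ≤ ⊥ := by
    rw [closure_le]
    rintro x ⟨-, hx⟩
    by_contra hx1
    exact hno x x.2 (fun h ↦ hx1 (Subtype.ext h)) (hx.map K.subtype)
  have : y = 1 := this hmem
  rw [this, orderOf_one] at hyo
  exact hp.ne_one hyo.symm

theorem commute_of_forall_isFocal_eq_one {K : Subgroup G}
    (h : ∀ p : ℕ, p.Prime → ∀ x ∈ K, IsFocal p x → x = 1) {a b : G} (ha : a ∈ K) (hb : b ∈ K) :
    Commute a b := by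
  have : Nat.card (⁅K, K⁆ : Subgroup G) = 1 := by
    rw [Nat.eq_one_iff_not_exists_prime_dvd]
    intro p hp hd
    obtain ⟨x, hx, hx1, hxf⟩ := exists_isFocal_of_dvd_card_commutator hp hd
    exact hx1 (h p hp x hx hxf)
  rw [← commutatorElement_eq_one_iff_commute]
  have h2 := commutator_mem_commutator ha hb
  rw [card_eq_one.1 this] at h2
  exact h2

end General

/-- Perfect groups with focal cores and without nontrivial normal `p`-subgroups. -/
structure IsPerfectFocal (G : Type*) [Group G] : Prop where
  hasFocalCores : HasFocalCores G
  commutator_eq_top : commutator G = ⊤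
  eq_bot_of_isPGroup : ∀ p : ℕ, p.Prime → ∀ N : Subgroup G, N.Normal → IsPGroup p N → N = ⊥

namespace IsPerfectFocal

variable {G : Type*} [Group G] [Finite G] (hG : IsPerfectFocal G) {p : ℕ} [hp : Fact p.Prime]
include hG

theorem sylow_le_closure (P : Sylow p G) :
    (P : Subgroup G) ≤ closure {x : G | x ∈ (P : Subgroup G) ∧ ∃ a ∈ (P : Subgroup G), ∃ u : G,
      x = ⁅a, u⁆} := by
  have h : commutator G ⊓ P = (P : Subgroup G) := by rw [hG.commutator_eq_top, top_inf_eq]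
  rw [commutator_inf_eq_focalSubgroup, focalSubgroup_def] at h
  exact h.ge

theorem sylow_le_of_forall_isFocal {P : Sylow p G} {D : Subgroup G}
    (h : ∀ x ∈ (P : Subgroup G), IsFocal p x → x ∈ D) : (P : Subgroup G) ≤ D := by
  refine (hG.sylow_le_closure P).trans ((closure_le D).2 ?_)
  rintro x ⟨hx, a, ha, u, hu⟩
  exact h x hx ⟨P, P.isPGroup', hx, a, ha, u, hu⟩

theorem exists_isFocal {P : Sylow p G} (hP : (P : Subgroup G) ≠ ⊥) :
    ∃ x ∈ (P : Subgroup G), x ≠ 1 ∧ IsFocal p x := by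
  by_contra! h
  refine hP (le_bot_iff.1 (hG.sylow_le_of_forall_isFocal fun x hx hxf ↦ ?_))
  by_contra hx1
  exact h x hx hx1 hxf

omit [Finite G] in
theorem normalizer_ne_top {D : Subgroup G} (hD : IsPGroup p D) (hne : D ≠ ⊥) :
    normalizer (D : Set G) ≠ ⊤ := fun h ↦
  hne (hG.eq_bot_of_isPGroup p hp.out D (normalizer_eq_top_iff.1 h) hD)

theorem mem_sylow_of_isFocal_of_mem_normalizer {P : Sylow p G} {D : Subgroup G} (hne : D ≠ ⊥)
    (hDP : D < P) (hmax : ∀ R : Sylow p G, D < (R : Subgroup G) ⊓ P → R = P) {x : G}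
    (hx : x ∈ normalizer (D : Set G)) (hxf : IsFocal p x) : x ∈ (P : Subgroup G) := by
  obtain ⟨K, hK, -, hKn, hxK⟩ := hG.hasFocalCores _
    (hG.normalizer_ne_top (P.isPGroup'.to_le hDP.le) hne) p hp.out x hx hxf
  obtain ⟨u, huP, huD, hu⟩ := IsPGroup.exists_mem_normalizer_of_lt hp.out P.isPGroup' hDP
  have hT : IsPGroup p (P ⊓ normalizer (D : Set G) : Subgroup G) := P.isPGroup'.to_le inf_le_left
  obtain ⟨R, hR⟩ := (hK.to_sup_of_normal_left' hT (inf_le_right.trans hKn)).exists_le_sylow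
  have hTR := le_sup_right.trans hR
  have hRP : R = P := by
    refine hmax R (lt_of_le_of_ne (le_inf ?_ hDP.le) fun h ↦ huD ?_)
    · exact (le_inf hDP.le le_normalizer).trans hTR
    · rw [h]
      exact ⟨hTR ⟨huP, hu⟩, huP⟩
  rw [← hRP]
  exact hR (le_sup_left (a := K) hxK)

theorem sylow_inf_eq_bot {P Q : Sylow p G} (hPQ : P ≠ Q) : (P ⊓ Q : Subgroup G) = ⊥ := by
  by_contra hbot
  obtain ⟨⟨P, Q⟩, ⟨hPQ, hbot⟩, hmax⟩ := Set.exists_max_image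
    {R : Sylow p G × Sylow p G | R.1 ≠ R.2 ∧ (R.1 ⊓ R.2 : Subgroup G) ≠ ⊥}
    (fun R ↦ Nat.card (R.1 ⊓ R.2 : Subgroup G)) (Set.toFinite _) ⟨(P, Q), hPQ, hbot⟩
  dsimp only at hPQ hbot hmax
  set D : Subgroup G := P ⊓ Q with hD
  have hmax' (P' R : Sylow p G) (h : D < (R : Subgroup G) ⊓ P') : R = P' := by
    by_contra hne
    have := hmax (R, P') ⟨hne, fun h0 ↦ not_lt_bot (h0 ▸ h)⟩
    exact h.ne (eq_of_le_of_card_ge h.le this)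
  have hDP : D < P := lt_of_le_of_ne inf_le_left fun h ↦
    hPQ (Sylow.ext (P.is_maximal' Q.isPGroup' (inf_eq_left.1 h)).symm)
  have hDQ : D < Q := lt_of_le_of_ne inf_le_right fun h ↦
    hPQ (Sylow.ext (Q.is_maximal' P.isPGroup' (inf_eq_right.1 h)))
  have hfoc {x : G} (hx : x ∈ normalizer (D : Set G)) (hxf : IsFocal p x) : x ∈ D :=
    ⟨hG.mem_sylow_of_isFocal_of_mem_normalizer hbot hDP (hmax' P) hx hxf,
      hG.mem_sylow_of_isFocal_of_mem_normalizer hbot hDQ (hmax' Q) hx hxf⟩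
  have hPN : (P : Subgroup G) ≤ normalizer (D : Set G) := by
    by_contra hnot
    have hlt : (P ⊓ normalizer (D : Set G) : Subgroup G) < P :=
      lt_of_le_of_ne inf_le_left fun h ↦ hnot (inf_eq_left.1 h)
    obtain ⟨u, huP, huT, hu⟩ := IsPGroup.exists_mem_normalizer_of_lt hp.out P.isPGroup' hlt
    refine huT ⟨huP, mem_normalizer_of_conj_mem fun d hd ↦ ?_⟩
    have hdT : d ∈ (P ⊓ normalizer (D : Set G) : Subgroup G) := ⟨hDP.le hd, le_normalizer hd⟩
    have hc : ⁅d, u⁆ ∈ (P ⊓ normalizer (D : Set G) : Subgroup G) := by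
      have := mul_mem hdT ((mem_normalizer_iff.1 hu _).1 (inv_mem hdT))
      simpa [commutatorElement_def, mul_assoc] using this
    have := hfoc hc.2 ⟨P, P.isPGroup', hc.1, d, hDP.le hd, u, rfl⟩
    have := mul_mem (inv_mem this) hd
    simpa [commutatorElement_def, mul_assoc] using this
  exact hDP.not_ge (hG.sylow_le_of_forall_isFocal fun x hx hxf ↦ hfoc (hPN hx) hxf)

theorem sylow_eq_of_mem {P Q : Sylow p G} {x : G} (hP : x ∈ (P : Subgroup G))
    (hQ : x ∈ (Q : Subgroup G)) (hx : x ≠ 1) : P = Q := by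
  by_contra h
  have : x ∈ (P ⊓ Q : Subgroup G) := ⟨hP, hQ⟩
  rw [hG.sylow_inf_eq_bot h] at this
  exact hx this

theorem mem_normalizer_of_conj_mem {P : Sylow p G} {x g : G} (hx : x ∈ (P : Subgroup G))
    (hx1 : x ≠ 1) (hg : g * x * g⁻¹ ∈ (P : Subgroup G)) :
    g ∈ normalizer ((P : Subgroup G) : Set G) := by
  refine Sylow.smul_eq_iff_mem_normalizer.1 ?_
  refine hG.sylow_eq_of_mem (x := g * x * g⁻¹) ?_ hg (by simpa using hx1)
  exact smul_mem_pointwise_smul x (MulAut.conj g) (P : Subgroup G) hx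

theorem mem_normalizer_of_commute {P : Sylow p G} {x g : G} (hx : x ∈ (P : Subgroup G))
    (hx1 : x ≠ 1) (hg : Commute g x) : g ∈ normalizer ((P : Subgroup G) : Set G) :=
  hG.mem_normalizer_of_conj_mem hx hx1 (by rwa [hg.eq, mul_inv_cancel_right])

theorem le_normalizer_of_isFocal {P : Sylow p G} {M : Subgroup G} (hM : M ≠ ⊤) {x : G}
    (hxM : x ∈ M) (hxP : x ∈ (P : Subgroup G)) (hx1 : x ≠ 1) (hxf : IsFocal p x) :
    M ≤ normalizer ((P : Subgroup G) : Set G) := by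
  obtain ⟨K, hK, -, hKn, hxK⟩ := hG.hasFocalCores M hM p hp.out x hxM hxf
  obtain ⟨R, hR⟩ := hK.exists_le_sylow
  obtain rfl := hG.sylow_eq_of_mem hxP (hR hxK) hx1
  exact fun m hm ↦ hG.mem_normalizer_of_conj_mem hxP hx1
    (hR ((mem_normalizer_iff.1 (hKn hm) x).1 hxK))

theorem le_normalizer_of_sylow_le {P : Sylow p G} (hP : (P : Subgroup G) ≠ ⊥) {M : Subgroup G}
    (hM : M ≠ ⊤) (hPM : (P : Subgroup G) ≤ M) : M ≤ normalizer ((P : Subgroup G) : Set G) := by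
  obtain ⟨x, hx, hx1, hxf⟩ := hG.exists_isFocal hP
  exact hG.le_normalizer_of_isFocal hM (hPM hx) hx hx1 hxf

theorem normalizer_eq_of_isFocal {r : ℕ} [hr : Fact r.Prime] {P : Sylow p G} {R : Sylow r G}
    (hP : (P : Subgroup G) ≠ ⊥) {x : G} (hx : x ∈ normalizer ((P : Subgroup G) : Set G))
    (hxR : x ∈ (R : Subgroup G)) (hx1 : x ≠ 1) (hxf : IsFocal r x) :
    normalizer ((R : Subgroup G) : Set G) = normalizer ((P : Subgroup G) : Set G) := by
  have hR : (R : Subgroup G) ≠ ⊥ := fun h ↦ hx1 (by rwa [h] at hxR)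
  have h := hG.le_normalizer_of_isFocal (hG.normalizer_ne_top P.isPGroup' hP) hx hxR hx1 hxf
  exact le_antisymm (hG.le_normalizer_of_sylow_le hP (hG.normalizer_ne_top R.isPGroup' hR)
    (le_normalizer.trans h)) h

theorem eq_one_of_isFocal {q r : ℕ} [hq : Fact q.Prime] (hr : r.Prime) {P : Sylow p G}
    {Q : Sylow q G} (hP : (P : Subgroup G) ≠ ⊥) (hQ : (Q : Subgroup G) ≠ ⊥)
    (hPQ : normalizer ((P : Subgroup G) : Set G) ≠ normalizer ((Q : Subgroup G) : Set G)) {x : G}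
    (hxP : x ∈ normalizer ((P : Subgroup G) : Set G))
    (hxQ : x ∈ normalizer ((Q : Subgroup G) : Set G)) (hxf : IsFocal r x) : x = 1 := by
  by_contra hx1
  have : Fact r.Prime := ⟨hr⟩
  obtain ⟨R, hR⟩ := exists_sylow_mem hxf.exists_pow_eq_one
  exact hPQ ((hG.normalizer_eq_of_isFocal hP hxP hR hx1 hxf).symm.trans
    (hG.normalizer_eq_of_isFocal hQ hxQ hR hx1 hxf))

end IsPerfectFocal

section General

variable {G : Type*} [Group G]

theorem mul_pow_mem_commutator (x y : G) :
    (x * y) ^ (orderOf x * orderOf y) ∈ commutator G := by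
  rw [← Abelianization.ker_of, MonoidHom.mem_ker, map_pow, map_mul, mul_pow, ← map_pow, ← map_pow,
    pow_mul, pow_orderOf_eq_one, mul_comm (orderOf x), pow_mul, pow_orderOf_eq_one]
  simp

theorem dvd_of_dvd_orderOf_mul {M : Subgroup G} {x y : G} (hx : x ∈ M) (hy : y ∈ M) {r : ℕ}
    (hr : r.Prime) (h : r ∣ orderOf (x * y)) :
    r ∣ orderOf x ∨ r ∣ orderOf y ∨ r ∣ Nat.card (⁅M, M⁆ : Subgroup G) := by
  have hmem : (x * y) ^ (orderOf x * orderOf y) ∈ ⁅M, M⁆ := by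
    rw [← M.map_subtype_commutator]
    refine ⟨_, mul_pow_mem_commutator (⟨x, hx⟩ : M) ⟨y, hy⟩, ?_⟩
    simp
  have h1 : (x * y) ^ (orderOf x * orderOf y * Nat.card (⁅M, M⁆ : Subgroup G)) = 1 := by
    rw [pow_mul]
    exact congrArg Subtype.val (pow_card_eq_one' (x := (⟨_, hmem⟩ : (⁅M, M⁆ : Subgroup G))))
  have h2 := h.trans (orderOf_dvd_of_pow_eq_one h1)
  rwa [hr.dvd_mul, hr.dvd_mul, or_assoc] at h2

/-- `M` is the normalizer of a nontrivial Sylow `r`-subgroup. -/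
def IsLocalPrime (M : Subgroup G) (r : ℕ) : Prop :=
  r.Prime ∧ ∃ R : Sylow r G, (R : Subgroup G) ≠ ⊥ ∧ normalizer ((R : Subgroup G) : Set G) = M

/-- The subgroup generated by the elements of `M` whose order involves only primes `r` such that
`M` is the normalizer of a nontrivial Sylow `r`-subgroup. -/
def localHall (M : Subgroup G) : Subgroup G :=
  closure {x | x ∈ M ∧ ∀ r : ℕ, r.Prime → r ∣ orderOf x → IsLocalPrime M r}

theorem localHall_le (M : Subgroup G) : localHall M ≤ M :=
  (closure_le M).2 fun _ hx ↦ hx.1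

theorem mem_localHall {M : Subgroup G}
    (hM : ∀ r : ℕ, r.Prime → r ∣ Nat.card (⁅M, M⁆ : Subgroup G) → IsLocalPrime M r) {x : G} :
    x ∈ localHall M ↔ x ∈ M ∧ ∀ r : ℕ, r.Prime → r ∣ orderOf x → IsLocalPrime M r := by
  refine ⟨fun hx ↦ ?_, fun hx ↦ subset_closure hx⟩
  induction hx using closure_induction with
  | mem x hx => exact hx
  | one => exact ⟨M.one_mem, fun r hr h ↦ absurd (by simpa using h) hr.ne_one⟩
  | mul x y _ _ hx hy =>
    refine ⟨mul_mem hx.1 hy.1, fun r hr h ↦ ?_⟩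
    obtain h | h | h := dvd_of_dvd_orderOf_mul hx.1 hy.1 hr h
    exacts [hx.2 r hr h, hy.2 r hr h, hM r hr h]
  | inv x _ hx => exact ⟨inv_mem hx.1, fun r hr h ↦ hx.2 r hr (by rwa [orderOf_inv] at h)⟩

end General

namespace IsPerfectFocal

variable {G : Type*} [Group G] [Finite G] (hG : IsPerfectFocal G)
include hG

theorem isLocalPrime_of_dvd_card_commutator {M : Subgroup G} {p : ℕ} (hM : IsLocalPrime M p)
    {r : ℕ} (hr : r.Prime) (h : r ∣ Nat.card (⁅M, M⁆ : Subgroup G)) : IsLocalPrime M r := by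
  obtain ⟨hp, P, hP, rfl⟩ := hM
  have : Fact p.Prime := ⟨hp⟩
  have : Fact r.Prime := ⟨hr⟩
  obtain ⟨x, hx, hx1, hxf⟩ := exists_isFocal_of_dvd_card_commutator hr h
  obtain ⟨R, hR⟩ := exists_sylow_mem hxf.exists_pow_eq_one
  exact ⟨hr, R, fun h0 ↦ hx1 (by rwa [h0] at hR), hG.normalizer_eq_of_isFocal hP hx hR hx1 hxf⟩

theorem mem_localHall_iff {M : Subgroup G} {p : ℕ} (hM : IsLocalPrime M p) {x : G} :
    x ∈ localHall M ↔ x ∈ M ∧ ∀ r : ℕ, r.Prime → r ∣ orderOf x → IsLocalPrime M r :=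
  mem_localHall fun _ hr h ↦ hG.isLocalPrime_of_dvd_card_commutator hM hr h

theorem commutator_le_localHall {M : Subgroup G} {p : ℕ} (hM : IsLocalPrime M p) :
    ⁅M, M⁆ ≤ localHall M := fun x hx ↦ by
  refine (hG.mem_localHall_iff hM).2 ⟨commutator_le_self M hx, fun r hr h ↦
    hG.isLocalPrime_of_dvd_card_commutator hM hr (h.trans ?_)⟩
  exact Subgroup.orderOf_dvd_natCard _ hx

theorem eq_one_of_isFocal_of_mem {M N : Subgroup G} {p q r : ℕ} (hM : IsLocalPrime M p)
    (hN : IsLocalPrime N q) (hMN : M ≠ N) (hr : r.Prime) {x : G} (hxM : x ∈ M) (hxN : x ∈ N)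
    (hx : IsFocal r x) : x = 1 := by
  obtain ⟨hp, P, hP, rfl⟩ := hM
  obtain ⟨hq, Q, hQ, rfl⟩ := hN
  have : Fact p.Prime := ⟨hp⟩
  have : Fact q.Prime := ⟨hq⟩
  exact hG.eq_one_of_isFocal hr hP hQ hMN hxM hxN hx

theorem commute_of_mem {M N : Subgroup G} {p q : ℕ} (hM : IsLocalPrime M p)
    (hN : IsLocalPrime N q) (hMN : M ≠ N) {x y : G} (hx : x ∈ M ⊓ N) (hy : y ∈ M ⊓ N) :
    Commute x y :=
  commute_of_forall_isFocal_eq_one (K := M ⊓ N)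
    (fun _ hr _ hz hzf ↦ hG.eq_one_of_isFocal_of_mem hM hN hMN hr hz.1 hz.2 hzf) hx hy

theorem sylow_le_commutator_of_isLocalPrime {p : ℕ} [hp : Fact p.Prime] {P : Sylow p G}
    (h : ∀ q : ℕ, q.Prime → ∀ t ∈ normalizer ((P : Subgroup G) : Set G), orderOf t = q →
      IsLocalPrime (normalizer ((P : Subgroup G) : Set G)) q) :
    (P : Subgroup G) ≤ ⁅(P : Subgroup G), (P : Subgroup G)⁆ := by
  refine (hG.sylow_le_closure P).trans ((closure_le _).2 ?_)
  rintro x ⟨hx, a, ha, u, rfl⟩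
  obtain rfl | ha1 := eq_or_ne a 1
  · simp
  have hu : u ∈ normalizer ((P : Subgroup G) : Set G) := by
    have := mul_mem (inv_mem hx) ha
    exact hG.mem_normalizer_of_conj_mem ha ha1
      (by simpa [commutatorElement_def, mul_assoc] using this)
  obtain ⟨i, j, hij, hi, hj⟩ := exists_pow_mul_pow_eq u hp.out
  have hiP := P.mem_of_mem_normalizer hi (pow_mem hu i)
  have hcomm : u ^ j ∈ centralizer ({a} : Set G) := by
    refine mem_of_forall_primary_pow_mem _ fun r hr hrj y hy hyr ↦ ?_
    have : Fact r.Prime := ⟨hr⟩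
    have hyN : y ∈ normalizer ((P : Subgroup G) : Set G) :=
      (zpowers_le.2 (pow_mem hu j)) hy
    have hrp : p ≠ r := fun h ↦ hr.one_lt.ne' (Nat.eq_one_of_dvd_coprimes hj hrj (h ▸ dvd_rfl))
    obtain ⟨-, R, hR, hRP⟩ := h r hr _ (pow_mem (pow_mem hu j) (orderOf (u ^ j) / r))
      (orderOf_pow_orderOf_div (orderOf_pos _).ne' hrj)
    have hyR : y ∈ (R : Subgroup G) := R.mem_of_mem_normalizer hyr (by rwa [hRP])
    have haR : a ∈ normalizer ((R : Subgroup G) : Set G) := by rw [hRP]; exact le_normalizer ha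
    have hd := IsPGroup.disjoint_of_ne p r hrp _ _ P.isPGroup' R.isPGroup'
    rw [mem_centralizer_singleton_iff]
    refine (commutatorElement_eq_one_iff_mul_comm.1 ?_)
    refine (disjoint_def.1 hd) ?_ ?_
    · exact mul_mem ((mem_normalizer_iff.1 hyN _).1 ha) (inv_mem ha)
    · have := mul_mem hyR ((mem_normalizer_iff.1 haR _).1 (inv_mem hyR))
      simpa only [commutatorElement_def, mul_assoc] using this
  have : ⁅a, u⁆ = ⁅a, u ^ i⁆ := by
    have hc : u ^ j * a⁻¹ * (u ^ j)⁻¹ = a⁻¹ := by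
      rw [mul_inv_eq_iff_eq_mul]
      exact (Commute.inv_left (mem_centralizer_singleton_iff.1 hcomm).symm).eq.symm
    conv_lhs => rw [hij]
    simp only [commutatorElement_def, mul_inv_rev, mul_assoc] at hc ⊢
    rw [← mul_assoc (u ^ j), ← mul_assoc (u ^ j * a⁻¹), mul_assoc (u ^ j), hc]
  rw [this]
  exact commutator_mem_commutator ha hiP

theorem exists_orderOf_eq_prime {M : Subgroup G} {p : ℕ} (hM : IsLocalPrime M p) :
    ∃ q : ℕ, q.Prime ∧ ¬ IsLocalPrime M q ∧ ∃ t ∈ M, orderOf t = q := by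
  obtain ⟨hp, P, hP, rfl⟩ := hM
  have : Fact p.Prime := ⟨hp⟩
  by_contra! hno
  have h := hG.sylow_le_commutator_of_isLocalPrime (P := P) fun q hq t ht htq ↦ by
    by_contra hq'
    exact hno q hq hq' t ht htq
  have : Group.IsNilpotent P := P.isPGroup'.isNilpotent
  have : Nontrivial P := (nontrivial_iff_ne_bot _).2 hP
  have hlt := Group.IsSolvable.commutator_lt_top_of_nontrivial P
  refine hlt.ne ?_
  rw [eq_top_iff]
  intro x _
  have := h x.2
  rw [← map_subtype_commutator] at this
  obtain ⟨y, hy, hyx⟩ := this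
  rwa [← Subtype.ext hyx]

omit hG in
theorem exists_isFocal_of_forall_not_commute {q : ℕ} {Q : Sylow q G} {s : G}
    (hs : s ∈ normalizer ((Q : Subgroup G) : Set G))
    (h : ∀ y ∈ (Q : Subgroup G), Commute y s → y = 1) {t : G} (ht : t ∈ (Q : Subgroup G)) :
    IsFocal q t := by
  have hmem (y : Q) : ⁅(y : G), s⁆ ∈ (Q : Subgroup G) := by
    have hy : (y : G) ∈ (Q : Subgroup G) := y.2
    have := mul_mem hy ((mem_normalizer_iff.1 hs _).1 (inv_mem hy))
    simpa only [commutatorElement_def, mul_assoc] using this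
  have hinj : Function.Injective fun y : Q ↦ (⟨⁅(y : G), s⁆, hmem y⟩ : Q) := by
    intro y z hyz
    have hyz : ⁅(y : G), s⁆ = ⁅(z : G), s⁆ := congrArg Subtype.val hyz
    have := h ((z : G)⁻¹ * y) (mul_mem (inv_mem z.2) y.2) ?_
    · exact Subtype.ext (inv_mul_eq_one.1 this).symm
    · rw [commutatorElement_def, commutatorElement_def] at hyz
      have h1 : (y : G) * s * (y : G)⁻¹ = z * s * (z : G)⁻¹ := mul_right_cancel hyz
      calc (z : G)⁻¹ * y * s = (z : G)⁻¹ * (y * s * (y : G)⁻¹) * y := by group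
        _ = s * ((z : G)⁻¹ * y) := by rw [h1]; group
  obtain ⟨y, hy⟩ := Finite.surjective_of_injective hinj ⟨t, ht⟩
  exact ⟨Q, Q.isPGroup', ht, y, y.2, s, (congrArg Subtype.val hy).symm⟩

end IsPerfectFocal

section General

variable {G : Type*} [Group G]

theorem card_mul_card_inf_of_sup_eq_top {A B : Subgroup G} [A.Normal] (h : A ⊔ B = ⊤) :
    Nat.card G * Nat.card (B ⊓ A : Subgroup G) = Nat.card A * Nat.card B := by
  have h1 : A.relIndex B = A.index := by rw [← relIndex_sup_left, h, relIndex_top_right]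
  have h2 := (A.subgroupOf B).card_mul_index
  rw [← relIndex, h1, ← inf_subgroupOf_left,
    Nat.card_congr (subgroupOfEquivOfLe (inf_le_left : B ⊓ A ≤ B)).toEquiv] at h2
  rw [← A.card_mul_index, ← h2]
  ring

theorem orderOf_conj (g x : G) : orderOf (g * x * g⁻¹) = orderOf x :=
  (MulAut.conj g).orderOf_eq x

theorem IsLocalPrime.exists_sylow {M : Subgroup G} {r : ℕ} (h : IsLocalPrime M r) :
    ∃ R : Sylow r G, normalizer ((R : Subgroup G) : Set G) = M ∧
      ∀ y ∈ M, (∃ k, y ^ r ^ k = 1) → y ∈ (R : Subgroup G) := by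
  obtain ⟨-, R, -, rfl⟩ := h
  exact ⟨R, rfl, fun y hy hk ↦ R.mem_of_mem_normalizer hk hy⟩

/-- `M` is the normalizer of a Sylow subgroup that meets `L` nontrivially. -/
def IsAttached (L M : Subgroup G) : Prop :=
  ∃ r : ℕ, r.Prime ∧ ∃ R : Sylow r G, normalizer ((R : Subgroup G) : Set G) = M ∧
    ∃ y ∈ (R : Subgroup G), y ∈ L ∧ y ≠ 1

/-- `L` is the intersection of two distinct Sylow normalizers attached to it. -/
def IsJunction (L : Subgroup G) : Prop :=
  ∃ M N : Subgroup G, M ≠ N ∧ IsAttached L M ∧ IsAttached L N ∧ L = M ⊓ N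

theorem IsAttached.exists_isLocalPrime {L M : Subgroup G} (h : IsAttached L M) :
    ∃ r, IsLocalPrime M r := by
  obtain ⟨r, hr, R, hRM, y, hy, -, hy1⟩ := h
  exact ⟨r, hr, R, fun h0 ↦ hy1 (by rwa [h0] at hy), hRM⟩

theorem exists_prime_dvd_orderOf {x : G} (hx : x ≠ 1) : ∃ r : ℕ, r.Prime ∧ r ∣ orderOf x :=
  Nat.exists_prime_and_dvd (orderOf_eq_one_iff.not.2 hx)

theorem exists_pow_ne_one [Finite G] {x : G} {r : ℕ} (hr : r.Prime) (h : r ∣ orderOf x) :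
    ∃ n : ℕ, x ^ n ≠ 1 ∧ ∃ k, (x ^ n) ^ r ^ k = 1 := by
  have hn := orderOf_pow_orderOf_div (orderOf_pos x).ne' h
  refine ⟨orderOf x / r, fun h1 ↦ hr.ne_one ?_, 1, ?_⟩
  · rw [← hn, h1, orderOf_one]
  · rw [pow_one, ← orderOf_dvd_iff_pow_eq_one, hn]

end General

namespace IsPerfectFocal

variable {G : Type*} [Group G] [Finite G] (hG : IsPerfectFocal G)
include hG

theorem exists_isJunction [Nontrivial G] : ∃ L : Subgroup G, IsJunction L := by
  obtain ⟨p, hp, hpG⟩ := Nat.exists_prime_and_dvd (Finite.one_lt_card (α := G)).ne'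
  have : Fact p.Prime := ⟨hp⟩
  have hP := (default : Sylow p G).ne_bot_of_dvd_card hpG
  obtain ⟨q, hq, hqP, t, ht, htq⟩ := hG.exists_orderOf_eq_prime ⟨hp, default, hP, rfl⟩
  set P : Sylow p G := default
  have : Fact q.Prime := ⟨hq⟩
  have ht1 : t ≠ 1 := fun h ↦ hq.ne_one (by rw [← htq, h, orderOf_one])
  obtain ⟨Q, hQ⟩ := exists_sylow_mem (p := q) (x := t)
    ⟨1, by rw [pow_one, ← htq, pow_orderOf_eq_one]⟩
  have hQ0 : (Q : Subgroup G) ≠ ⊥ := fun h ↦ ht1 (by rwa [h] at hQ)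
  have hPQ : normalizer ((P : Subgroup G) : Set G) ≠ normalizer ((Q : Subgroup G) : Set G) :=
    fun h ↦ hqP ⟨hq, Q, hQ0, h.symm⟩
  obtain ⟨r, hr, hrQ, s, hs, hsr⟩ := hG.exists_orderOf_eq_prime ⟨hq, Q, hQ0, rfl⟩
  have : Fact r.Prime := ⟨hr⟩
  have hs1 : s ≠ 1 := fun h ↦ hr.ne_one (by rw [← hsr, h, orderOf_one])
  obtain ⟨R, hR⟩ := exists_sylow_mem (p := r) (x := s)
    ⟨1, by rw [pow_one, ← hsr, pow_orderOf_eq_one]⟩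
  have hR0 : (R : Subgroup G) ≠ ⊥ := fun h ↦ hs1 (by rwa [h] at hR)
  by_cases hcomm : ∀ y ∈ (Q : Subgroup G), Commute y s → y = 1
  · exact absurd (hG.eq_one_of_isFocal hq hP hQ0 hPQ ht (le_normalizer hQ)
      (exists_isFocal_of_forall_not_commute hs hcomm hQ)) ht1
  · push Not at hcomm
    obtain ⟨y, hy, hys, hy1⟩ := hcomm
    exact ⟨normalizer ((Q : Subgroup G) : Set G) ⊓ normalizer ((R : Subgroup G) : Set G),
      _, _, fun h ↦ hrQ ⟨hr, R, hR0, h.symm⟩,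
      ⟨q, hq, Q, rfl, y, hy, ⟨le_normalizer hy, hG.mem_normalizer_of_commute hR hs1 hys⟩, hy1⟩,
      ⟨r, hr, R, rfl, s, hR, ⟨hs, le_normalizer hR⟩, hs1⟩, rfl⟩

theorem exists_mem_forall_commute {L M : Subgroup G} (h : IsAttached L M) :
    ∃ y ∈ L, ∀ g, Commute g y → g ∈ M := by
  obtain ⟨r, hr, R, rfl, y, hyR, hyL, hy1⟩ := h
  have : Fact r.Prime := ⟨hr⟩
  exact ⟨y, hyL, fun g hg ↦ hG.mem_normalizer_of_commute hyR hy1 hg⟩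

theorem mem_normalizer_iff_of_conj_mem {r : ℕ} [Fact r.Prime] {R S : Sylow r G} {x g : G}
    (hx : x ∈ (R : Subgroup G)) (hx1 : x ≠ 1) (hg : g * x * g⁻¹ ∈ (S : Subgroup G)) (h : G) :
    h ∈ normalizer ((R : Subgroup G) : Set G) ↔
      g * h * g⁻¹ ∈ normalizer ((S : Subgroup G) : Set G) := by
  have hgR : g * x * g⁻¹ ∈ ((g • R : Sylow r G) : Subgroup G) :=
    smul_mem_pointwise_smul x (MulAut.conj g) (R : Subgroup G) hx
  obtain rfl := hG.sylow_eq_of_mem hg hgR (by simpa using hx1)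
  have hconj : ∀ z, g * z * g⁻¹ ∈ ((g • R : Sylow r G) : Subgroup G) ↔ z ∈ (R : Subgroup G) :=
    fun z ↦ smul_mem_pointwise_smul_iff (a := MulAut.conj g) (S := (R : Subgroup G)) (x := z)
  constructor
  · intro hh
    refine hG.mem_normalizer_of_conj_mem hgR (by simpa using hx1) ?_
    have := (hconj _).2 ((mem_normalizer_iff.1 hh x).1 hx)
    convert this using 1
    group
  · intro hh
    refine hG.mem_normalizer_of_conj_mem hx hx1 ((hconj _).1 ?_)
    have := (mem_normalizer_iff.1 hh _).1 hgR
    convert this using 1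
    group

section Junction

variable {L : Subgroup G} (hL : IsJunction L)
include hL

theorem commute_of_isJunction {x y : G} (hx : x ∈ L) (hy : y ∈ L) : Commute x y := by
  obtain ⟨M, N, hMN, hM, hN, rfl⟩ := hL
  obtain ⟨_, hM⟩ := hM.exists_isLocalPrime
  obtain ⟨_, hN⟩ := hN.exists_isLocalPrime
  exact hG.commute_of_mem hM hN hMN hx hy

theorem eq_inf_of_isAttached {M N : Subgroup G} (hM : IsAttached L M) (hN : IsAttached L N)
    (hMN : M ≠ N) : L = M ⊓ N := by
  obtain ⟨y, hyL, hy⟩ := hG.exists_mem_forall_commute hM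
  obtain ⟨z, hzL, hz⟩ := hG.exists_mem_forall_commute hN
  have hle : L ≤ M ⊓ N := fun g hg ↦
    ⟨hy g (hG.commute_of_isJunction hL hg hyL), hz g (hG.commute_of_isJunction hL hg hzL)⟩
  refine le_antisymm hle fun g hg ↦ ?_
  obtain ⟨_, hM'⟩ := hM.exists_isLocalPrime
  obtain ⟨_, hN'⟩ := hN.exists_isLocalPrime
  obtain ⟨M₁, N₁, -, hM₁, hN₁, rfl⟩ := hL
  obtain ⟨y₁, hy₁L, hy₁⟩ := hG.exists_mem_forall_commute hM₁
  obtain ⟨z₁, hz₁L, hz₁⟩ := hG.exists_mem_forall_commute hN₁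
  exact ⟨hy₁ g (hG.commute_of_mem hM' hN' hMN hg (hle hy₁L)),
    hz₁ g (hG.commute_of_mem hM' hN' hMN hg (hle hz₁L))⟩

omit [Finite G] hG in
theorem exists_isAttached_ne (M : Subgroup G) : ∃ N, IsAttached L N ∧ M ≠ N := by
  obtain ⟨M₁, N₁, hne, hM₁, hN₁, -⟩ := hL
  by_cases h : M = M₁
  · exact ⟨N₁, hN₁, h ▸ hne⟩
  · exact ⟨M₁, hM₁, h⟩

theorem le_of_isAttached {M : Subgroup G} (hM : IsAttached L M) : L ≤ M := by
  obtain ⟨N, hN, hMN⟩ := exists_isAttached_ne hL M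
  exact (hG.eq_inf_of_isAttached hL hM hN hMN).trans_le inf_le_left

omit hL in
theorem conj_mem_of_isAttached {M : Subgroup G} (hM : IsAttached L M) {g : G}
    (hg : ∀ x ∈ L, g * x * g⁻¹ ∈ M) : g ∈ M := by
  obtain ⟨r, hr, R, rfl, y, hyR, hyL, hy1⟩ := hM
  have : Fact r.Prime := ⟨hr⟩
  obtain ⟨k, hk⟩ := IsPGroup.exists_pow_eq_one R.isPGroup' hyR
  refine hG.mem_normalizer_of_conj_mem hyR hy1 (R.mem_of_mem_normalizer ⟨k, ?_⟩ (hg y hyL))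
  rw [conj_pow, hk, mul_one, mul_inv_cancel]

theorem mem_of_forall_conj_mem {g : G} (hg : ∀ x ∈ L, g * x * g⁻¹ ∈ L) : g ∈ L := by
  have hL' := hL
  obtain ⟨M, N, -, hM, hN, hMN⟩ := hL'
  rw [hMN]
  exact ⟨hG.conj_mem_of_isAttached hM fun x hx ↦ hG.le_of_isAttached hL hM (hg x hx),
    hG.conj_mem_of_isAttached hN fun x hx ↦ hG.le_of_isAttached hL hN (hg x hx)⟩

omit hG hL in
theorem exists_isAttached_of_dvd_orderOf {x : G} (hx : x ∈ L) {r : ℕ} (hr : r.Prime)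
    (h : r ∣ orderOf x) :
    ∃ R : Sylow r G, IsAttached L (normalizer ((R : Subgroup G) : Set G)) ∧
      (R : Subgroup G) ≠ ⊥ ∧ ∃ n : ℕ, x ^ n ∈ (R : Subgroup G) ∧ x ^ n ≠ 1 := by
  obtain ⟨n, hn1, hn⟩ := exists_pow_ne_one hr h
  obtain ⟨R, hR⟩ := exists_sylow_mem hn
  exact ⟨R, ⟨r, hr, R, rfl, _, hR, pow_mem hx n, hn1⟩, fun h0 ↦ hn1 (by rwa [h0] at hR), n, hR, hn1⟩

theorem mem_of_commute {x g : G} (hx : x ∈ L) (hx1 : x ≠ 1)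
    (hxH : ∀ M, IsAttached L M → x ∉ localHall M) (hg : Commute g x) : g ∈ L := by
  obtain ⟨r, hr, hrx⟩ := exists_prime_dvd_orderOf hx1
  obtain ⟨R, hR, hR0, n, hn, hn1⟩ := exists_isAttached_of_dvd_orderOf hx hr hrx
  have : Fact r.Prime := ⟨hr⟩
  have h := hxH _ hR
  rw [hG.mem_localHall_iff ⟨hr, R, hR0, rfl⟩] at h
  push Not at h
  obtain ⟨s, hs, hsx, hsR⟩ := h (hG.le_of_isAttached hL hR hx)
  obtain ⟨S, hS, hS0, m, hm, hm1⟩ := exists_isAttached_of_dvd_orderOf hx hs hsx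
  have : Fact s.Prime := ⟨hs⟩
  rw [hG.eq_inf_of_isAttached hL hR hS fun h ↦ hsR ⟨hs, S, hS0, h.symm⟩]
  exact ⟨hG.mem_normalizer_of_commute hn hn1 (hg.pow_right n),
    hG.mem_normalizer_of_commute hm hm1 (hg.pow_right m)⟩

end Junction

end IsPerfectFocal

namespace IsPerfectFocal

variable {G : Type*} [Group G] [Finite G] (hG : IsPerfectFocal G)
include hG

theorem conj_mem_localHall {M : Subgroup G} {p : ℕ} (hM : IsLocalPrime M p) {g x : G} (hg : g ∈ M)
    (hx : x ∈ localHall M) : g * x * g⁻¹ ∈ localHall M := by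
  rw [hG.mem_localHall_iff hM] at hx ⊢
  rw [orderOf_conj]
  exact ⟨mul_mem (mul_mem hg hx.1) (inv_mem hg), hx.2⟩

theorem exists_sylow_of_mem_localHall {M : Subgroup G} {p : ℕ} (hM : IsLocalPrime M p) {x : G}
    (hx : x ∈ localHall M) {r : ℕ} (hr : r.Prime) (hrx : r ∣ orderOf x) :
    ∃ R : Sylow r G, normalizer ((R : Subgroup G) : Set G) = M ∧
      ∀ n k : ℕ, (x ^ n) ^ r ^ k = 1 → x ^ n ∈ (R : Subgroup G) := by
  rw [hG.mem_localHall_iff hM] at hx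
  obtain ⟨R, hRM, hR⟩ := (hx.2 r hr hrx).exists_sylow
  exact ⟨R, hRM, fun n k h ↦ hR _ (pow_mem hx.1 n) ⟨k, h⟩⟩

/-- Conjugate nontrivial elements of two subgroups `localHall M` and `localHall N` conjugate `M`
into `N`. -/
theorem mem_iff_of_conj_mem_localHall {M N : Subgroup G} {p q : ℕ} (hM : IsLocalPrime M p)
    (hN : IsLocalPrime N q) {x g : G} (hx : x ∈ localHall M) (hx1 : x ≠ 1)
    (hg : g * x * g⁻¹ ∈ localHall N) (h : G) : h ∈ M ↔ g * h * g⁻¹ ∈ N := by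
  obtain ⟨r, hr, hrx⟩ := exists_prime_dvd_orderOf hx1
  obtain ⟨n, hn1, k, hk⟩ := exists_pow_ne_one hr hrx
  have : Fact r.Prime := ⟨hr⟩
  obtain ⟨R, rfl, hR⟩ := hG.exists_sylow_of_mem_localHall hM hx hr hrx
  obtain ⟨S, rfl, hS⟩ := hG.exists_sylow_of_mem_localHall hN hg hr (by rwa [orderOf_conj])
  refine hG.mem_normalizer_iff_of_conj_mem (hR n k hk) hn1 ?_ h
  rw [← conj_pow]
  refine hS n k ?_
  rw [conj_pow, conj_pow, hk, mul_one, mul_inv_cancel]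

theorem mem_of_conj_mem_localHall {M : Subgroup G} {p : ℕ} (hM : IsLocalPrime M p) {x g : G}
    (hx : x ∈ localHall M) (hx1 : x ≠ 1) (hg : g * x * g⁻¹ ∈ localHall M) : g ∈ M := by
  obtain ⟨r, hr, hrx⟩ := exists_prime_dvd_orderOf hx1
  obtain ⟨n, hn1, k, hk⟩ := exists_pow_ne_one hr hrx
  have : Fact r.Prime := ⟨hr⟩
  have hgr : r ∣ orderOf (g * x * g⁻¹) := by rwa [orderOf_conj]
  have hgM := ((hG.mem_localHall_iff hM).1 hg)
  obtain ⟨R, rfl, hR⟩ := (hgM.2 r hr hgr).exists_sylow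
  have hxM := ((hG.mem_localHall_iff hM).1 hx).1
  refine hG.mem_normalizer_of_conj_mem (hR _ (pow_mem hxM n) ⟨k, hk⟩) hn1 ?_
  rw [← conj_pow]
  refine hR _ (pow_mem hgM.1 n) ⟨k, ?_⟩
  rw [conj_pow, conj_pow, hk, mul_one, mul_inv_cancel]

theorem sylow_le_localHall {p : ℕ} [hp : Fact p.Prime] {P : Sylow p G}
    (hP : (P : Subgroup G) ≠ ⊥) :
    (P : Subgroup G) ≤ localHall (normalizer ((P : Subgroup G) : Set G)) := fun x hx ↦ by
  have hM : IsLocalPrime (normalizer ((P : Subgroup G) : Set G)) p := ⟨hp.out, P, hP, rfl⟩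
  refine (hG.mem_localHall_iff hM).2 ⟨le_normalizer hx, fun r hr hrx ↦ ?_⟩
  obtain ⟨k, hk⟩ := IsPGroup.exists_pow_eq_one P.isPGroup' hx
  have h := hr.dvd_of_dvd_pow (hrx.trans (orderOf_dvd_of_pow_eq_one hk))
  rwa [(Nat.prime_dvd_prime_iff_eq hr hp.out).1 h]

section Junction

variable {L : Subgroup G} (hL : IsJunction L)
include hL

theorem two_mul_card_inf_le {M : Subgroup G} (hM : IsAttached L M) :
    2 * Nat.card (L ⊓ localHall M : Subgroup G) ≤ Nat.card (localHall M) := by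
  obtain ⟨N, hN, hMN⟩ := exists_isAttached_ne hL M
  have hLMN := hG.eq_inf_of_isAttached hL hM hN hMN
  have hnot : ¬ localHall M ≤ L := fun hle ↦ by
    obtain ⟨p, hp, P, hP, rfl⟩ := hM.exists_isLocalPrime
    obtain ⟨q, hN'⟩ := hN.exists_isLocalPrime
    have : Fact p.Prime := ⟨hp⟩
    obtain ⟨x, hx, hx1, hxf⟩ := hG.exists_isFocal hP
    have hxL := hle (hG.sylow_le_localHall hP hx)
    rw [hLMN] at hxL
    exact hx1 (hG.eq_one_of_isFocal_of_mem ⟨hp, P, hP, rfl⟩ hN' hMN hp hxL.1 hxL.2 hxf)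
  have h1 := (L.subgroupOf (localHall M)).card_mul_index
  have h2 : (L.subgroupOf (localHall M)).index ≠ 1 := fun h ↦ hnot (relIndex_eq_one.1 h)
  have h3 : (L.subgroupOf (localHall M)).index ≠ 0 := index_ne_zero_of_finite
  rw [← inf_subgroupOf_right,
    Nat.card_congr (subgroupOfEquivOfLe (inf_le_right : L ⊓ localHall M ≤ _)).toEquiv,
    inf_subgroupOf_right] at h1
  rw [← h1, mul_comm]
  exact Nat.mul_le_mul_left _ (by lia)

theorem sup_eq_of_isAttached {M : Subgroup G} (hM : IsAttached L M) :
    (localHall M).subgroupOf M ⊔ L.subgroupOf M = ⊤ := by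
  obtain ⟨N, hN, hMN⟩ := exists_isAttached_ne hL M
  have hLMN := hG.eq_inf_of_isAttached hL hM hN hMN
  obtain ⟨p, hM'⟩ := hM.exists_isLocalPrime
  obtain ⟨q, hq, Q, rfl, y, hyQ, hyL, hy1⟩ := hN
  have : Fact q.Prime := ⟨hq⟩
  have hyM := hG.le_of_isAttached hL hM hyL
  have hyq : ∃ k, (⟨y, hyM⟩ : M) ^ q ^ k = 1 := by
    obtain ⟨k, hk⟩ := IsPGroup.exists_pow_eq_one Q.isPGroup' hyQ
    exact ⟨k, Subtype.ext hk⟩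
  obtain ⟨S, hS⟩ := exists_sylow_mem hyq
  have hSQ : ∀ z ∈ (S : Subgroup M), (z : G) ∈ (Q : Subgroup G) := by
    obtain ⟨R, hR⟩ := (S.isPGroup'.map M.subtype).exists_le_sylow
    obtain rfl := hG.sylow_eq_of_mem hyQ (hR (mem_map_of_mem _ hS)) hy1
    exact fun z hz ↦ hR (mem_map_of_mem M.subtype hz)
  have hcomm : commutator M ≤ (localHall M).subgroupOf M := by
    rw [subgroupOf, ← map_le_iff_le_comap, map_subtype_commutator]
    exact hG.commutator_le_localHall hM'
  have : ((localHall M).subgroupOf M ⊔ S).Normal :=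
    Subgroup.Normal.of_commutator_le _ (hcomm.trans le_sup_left)
  have hfrat := S.normalizer_sup_eq_top' (N := (localHall M).subgroupOf M ⊔ S) le_sup_right
  have hnorm : normalizer ((S : Subgroup M) : Set M) ≤ L.subgroupOf M := fun m hm ↦ by
    rw [mem_subgroupOf, hLMN]
    refine ⟨m.2, hG.mem_normalizer_of_conj_mem hyQ hy1 ?_⟩
    exact hSQ _ ((mem_normalizer_iff.1 hm _).1 hS)
  rw [eq_top_iff, ← hfrat]
  exact sup_le (hnorm.trans le_sup_right) (sup_le le_sup_left
    (le_normalizer.trans (hnorm.trans le_sup_right)))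

theorem card_mul_card_inf {M : Subgroup G} (hM : IsAttached L M) :
    Nat.card M * Nat.card (L ⊓ localHall M : Subgroup G) =
      Nat.card (localHall M) * Nat.card L := by
  obtain ⟨p, hM'⟩ := hM.exists_isLocalPrime
  have : ((localHall M).subgroupOf M).Normal :=
    ⟨fun x hx g ↦ hG.conj_mem_localHall hM' g.2 hx⟩
  have h := card_mul_card_inf_of_sup_eq_top (hG.sup_eq_of_isAttached hL hM)
  have hLM := hG.le_of_isAttached hL hM
  rwa [Nat.card_congr (subgroupOfEquivOfLe (localHall_le M)).toEquiv,
    Nat.card_congr (subgroupOfEquivOfLe hLM).toEquiv, subgroupOf, subgroupOf, ← comap_inf,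
    ← subgroupOf,
    Nat.card_congr (subgroupOfEquivOfLe (inf_le_left.trans hLM)).toEquiv] at h

theorem conj_notMem_localHall {M N : Subgroup G} (hM : IsAttached L M) (hN : IsAttached L N)
    (hMN : M ≠ N) {x : G} (hx : x ∈ localHall M) (hx1 : x ≠ 1) (g : G) :
    g * x * g⁻¹ ∉ localHall N := fun hg ↦ by
  obtain ⟨p, hM'⟩ := hM.exists_isLocalPrime
  obtain ⟨q, hN'⟩ := hN.exists_isLocalPrime
  have h := hG.mem_iff_of_conj_mem_localHall hM' hN' hx hx1 hg
  have hgM : g⁻¹ ∈ M := hG.conj_mem_of_isAttached hM fun y hy ↦ by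
    rw [h]
    simpa [mul_assoc] using hG.le_of_isAttached hL hN hy
  refine hMN (Subgroup.ext fun z ↦ ?_)
  have h1 := h (g⁻¹ * z * g)
  rw [M.mul_mem_cancel_right (inv_mem_iff.1 hgM), M.mul_mem_cancel_left hgM] at h1
  simpa [mul_assoc] using h1

theorem conj_notMem_localHall_of_forall {M : Subgroup G} (hM : IsAttached L M) {x : G}
    (hx : x ∈ L) (hx1 : x ≠ 1) (hxH : ∀ N, IsAttached L N → x ∉ localHall N) (g : G) :
    g * x * g⁻¹ ∉ localHall M := fun hg ↦ by
  obtain ⟨p, hM'⟩ := hM.exists_isLocalPrime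
  have key {r : ℕ} (hr : r.Prime) (hrx : r ∣ orderOf x) : ∃ N, IsLocalPrime N r ∧ IsAttached L N ∧
      ∀ z, z ∈ N ↔ g * z * g⁻¹ ∈ M := by
    have : Fact r.Prime := ⟨hr⟩
    obtain ⟨R, hR, hR0, n, hn, hn1⟩ := exists_isAttached_of_dvd_orderOf hx hr hrx
    obtain ⟨S, rfl, hS⟩ := hG.exists_sylow_of_mem_localHall hM' hg hr (by rwa [orderOf_conj])
    refine ⟨_, ⟨hr, R, hR0, rfl⟩, hR, fun z ↦ hG.mem_normalizer_iff_of_conj_mem hn hn1 ?_ z⟩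
    obtain ⟨k, hk⟩ := IsPGroup.exists_pow_eq_one R.isPGroup' hn
    rw [← conj_pow]
    refine hS n k ?_
    rw [conj_pow, conj_pow, hk, mul_one, mul_inv_cancel]
  obtain ⟨r, hr, hrx⟩ := exists_prime_dvd_orderOf hx1
  obtain ⟨N, hNr, hN, hNM⟩ := key hr hrx
  refine hxH N hN ((hG.mem_localHall_iff hNr).2 ⟨hG.le_of_isAttached hL hN hx, fun s hs hsx ↦ ?_⟩)
  obtain ⟨N', hNs, -, hN'M⟩ := key hs hsx
  rwa [Subgroup.ext fun z ↦ (hNM z).trans (hN'M z).symm]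

end Junction

end IsPerfectFocal

section General

variable {G : Type*} [Group G]

/-- The union of the conjugates of `S`. -/
def conjUnion (S : Set G) : Set G :=
  {x | ∃ g : G, g * x * g⁻¹ ∈ S}

/-- Counting the conjugates of a trivial intersection set. -/
theorem card_mul_ncard_conjUnion {N : Subgroup G} {S : Set G}
    (hconj : ∀ n ∈ N, ∀ s ∈ S, n * s * n⁻¹ ∈ S)
    (hTI : ∀ s ∈ S, ∀ g : G, g * s * g⁻¹ ∈ S → g ∈ N) :
    Nat.card N * (conjUnion S).ncard = Nat.card G * S.ncard := by
  choose f hf using fun x : conjUnion S ↦ x.2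
  rw [← Nat.card_coe_set_eq, ← Nat.card_coe_set_eq, ← Nat.card_prod, ← Nat.card_prod]
  refine Nat.card_congr (Equiv.ofBijective (fun y : N × conjUnion S ↦
    (⟨y.1 * f y.2, ⟨y.1 * (f y.2 * y.2 * (f y.2)⁻¹) * (y.1 : G)⁻¹,
      hconj _ y.1.2 _ (hf y.2)⟩⟩ : G × S)) ⟨?_, ?_⟩)
  · rintro ⟨⟨n, hn⟩, ⟨x, hx⟩⟩ ⟨⟨m, hm⟩, ⟨y, hy⟩⟩ h
    obtain ⟨h1, h2⟩ := Prod.ext_iff.1 h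
    dsimp only at h1 h2
    have h2 := congrArg Subtype.val h2
    dsimp only at h2
    have hxy : x = y := by
      have h3 : n * f ⟨x, hx⟩ * x * (n * f ⟨x, hx⟩)⁻¹ = m * f ⟨y, hy⟩ * y * (m * f ⟨y, hy⟩)⁻¹ := by
        simpa only [mul_inv_rev, mul_assoc] using h2
      rw [h1] at h3
      exact mul_left_cancel (mul_right_cancel h3)
    subst hxy
    simpa using h1
  · rintro ⟨g, s, hs⟩
    have hgs : g * (g⁻¹ * s * g) * g⁻¹ = s := by group
    have hx : g⁻¹ * s * g ∈ conjUnion S := ⟨g, by rwa [hgs]⟩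
    have hn : g * (f ⟨_, hx⟩)⁻¹ ∈ N := by
      refine hTI _ (hf ⟨_, hx⟩) _ ?_
      convert hs using 1
      group
    refine ⟨⟨⟨_, hn⟩, ⟨_, hx⟩⟩, Prod.ext ?_ (Subtype.ext ?_)⟩
    · simp
    · dsimp only
      group

theorem two_mul_le_of_card_eq {g l m e h X : ℕ} (h1 : m * X = g * (h - 1)) (h2 : m * e = h * l)
    (h3 : 2 * e ≤ h) (he : 0 < e) : g * (2 * e - 1) ≤ 2 * l * X := by
  obtain ⟨e, rfl⟩ := Nat.exists_eq_add_of_le' he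
  obtain ⟨h, rfl⟩ := Nat.exists_eq_add_of_le' (show 1 ≤ h by lia)
  have h4 : 2 * (e + 1) - 1 = 2 * e + 1 := by lia
  rw [Nat.add_sub_cancel] at h1
  rw [h4]
  have h5 : (h + 1) * (2 * l * X) = 2 * (e + 1) * (g * h) := by
    calc (h + 1) * (2 * l * X) = 2 * X * ((h + 1) * l) := by ring
      _ = 2 * (e + 1) * (m * X) := by rw [← h2]; ring
      _ = 2 * (e + 1) * (g * h) := by rw [h1]
  refine le_of_mul_le_mul_left (a := h + 1) ?_ h.succ_pos
  rw [h5]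
  have h6 := Nat.mul_le_mul_left g (show (h + 1) * (2 * e + 1) ≤ 2 * (e + 1) * h by nlinarith)
  linarith

end General

/-- A group is not covered economically by the conjugates of `L` and of a family of subgroups
`H i` that normalizers `M i` make into trivial intersection sets. -/
theorem false_of_conj_disjoint {G ι : Type*} [Group G] [Finite G] [Finite ι] [Nontrivial ι]
    {L : Subgroup G} {M H : ι → Subgroup G} {S : Set G}
    (hS : ∀ x, x ∈ S ↔ x ∈ L ∧ x ≠ 1 ∧ ∀ i, x ∉ H i)
    (hL : ∀ x ∈ L, ∀ y ∈ L, Commute x y)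
    (hSL : ∀ s ∈ S, ∀ g : G, g * s * g⁻¹ ∈ S → g ∈ L)
    (hM : ∀ i, ∀ g ∈ M i, ∀ x ∈ H i, g * x * g⁻¹ ∈ H i)
    (hHM : ∀ i, ∀ x ∈ H i, x ≠ 1 → ∀ g : G, g * x * g⁻¹ ∈ H i → g ∈ M i)
    (hcard : ∀ i, Nat.card (M i) * Nat.card (L ⊓ H i : Subgroup G) = Nat.card (H i) * Nat.card L)
    (htwo : ∀ i, 2 * Nat.card (L ⊓ H i : Subgroup G) ≤ Nat.card (H i))
    (hHH : ∀ i j, i ≠ j → ∀ x ∈ H i, x ≠ 1 → ∀ g : G, g * x * g⁻¹ ∉ H j)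
    (hSH : ∀ i, ∀ s ∈ S, ∀ g : G, g * s * g⁻¹ ∉ H i) : False := by
  classical
  have : Fintype ι := Fintype.ofFinite ι
  have hncard (K : Subgroup G) : ((K : Set G) \ {1}).ncard = Nat.card K - 1 := by
    rw [Set.ncard_sdiff_singleton_of_mem K.one_mem]
    rfl
  have hone {T : Set G} (hT : (1 : G) ∉ T) : (1 : G) ∉ conjUnion T := by
    rintro ⟨g, hg⟩
    exact hT (by simpa using hg)
  have hS1 : (1 : G) ∉ S := fun h ↦ ((hS 1).1 h).2.1 rfl
  set X : ι → Set G := fun i ↦ conjUnion ((H i : Set G) \ {1}) with hX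
  have hX0 : Nat.card L * (conjUnion S).ncard = Nat.card G * S.ncard := by
    refine card_mul_ncard_conjUnion (fun n hn s hs ↦ ?_) hSL
    rwa [(hL n hn s ((hS s).1 hs).1).eq, mul_inv_cancel_right]
  have hXi (i : ι) : Nat.card (M i) * (X i).ncard = Nat.card G * (Nat.card (H i) - 1) := by
    rw [← hncard]
    refine card_mul_ncard_conjUnion (fun n hn s hs ↦ ⟨hM i n hn s hs.1, ?_⟩)
      fun s hs g hg ↦ hHM i s hs.1 hs.2 g hg.1
    have := hs.2
    simpa using this
  have hbound (i : ι) := two_mul_le_of_card_eq (hXi i) (hcard i) (htwo i) Nat.card_pos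
  have hcover : Nat.card L - 1 ≤ S.ncard + ∑ i, (Nat.card (L ⊓ H i : Subgroup G) - 1) := by
    have hsub : (L : Set G) \ {1} ⊆ S ∪ ⋃ i, (((L ⊓ H i : Subgroup G) : Set G) \ {1}) := by
      rintro x ⟨hxL, hx1⟩
      by_cases hx : ∀ i, x ∉ H i
      · exact Or.inl ((hS x).2 ⟨hxL, hx1, hx⟩)
      · push Not at hx
        obtain ⟨i, hi⟩ := hx
        exact Or.inr (Set.mem_iUnion.2 ⟨i, ⟨hxL, hi⟩, hx1⟩)
    rw [← hncard]
    refine (Set.ncard_le_ncard hsub (Set.toFinite _)).trans ((Set.ncard_union_le _ _).trans ?_)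
    refine Nat.add_le_add_left ((Set.ncard_iUnion_le_of_fintype _).trans ?_) _
    exact Finset.sum_le_sum fun i _ ↦ (hncard _).le
  have htotal : (conjUnion S).ncard + ∑ i, (X i).ncard + 1 ≤ Nat.card G := by
    have hdisj : Pairwise (Function.onFun Disjoint X) := by
      intro i j hij
      refine Set.disjoint_left.2 ?_
      rintro x ⟨g, hg, hg1⟩ ⟨k, hk, hk1⟩
      refine hHH i j hij _ hg hg1 (k * g⁻¹) ?_
      simpa [mul_assoc] using hk
    have hdisj0 : Disjoint (conjUnion S) (⋃ i, X i) := by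
      refine Set.disjoint_left.2 ?_
      rintro x ⟨g, hg⟩ hx
      obtain ⟨i, k, hk, hk1⟩ := Set.mem_iUnion.1 hx
      refine hSH i _ hg (k * g⁻¹) ?_
      simpa [mul_assoc] using hk
    have h1 : (1 : G) ∉ conjUnion S ∪ ⋃ i, X i := by
      rintro (h | h)
      · exact hone hS1 h
      · obtain ⟨i, hi⟩ := Set.mem_iUnion.1 h
        exact hone (by simp) hi
    have := Set.ncard_le_card (insert (1 : G) (conjUnion S ∪ ⋃ i, X i))
    rw [Set.ncard_insert_of_notMem h1, Set.ncard_union_eq hdisj0,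
      Set.ncard_iUnion_of_finite (fun _ ↦ Set.toFinite _) hdisj,
      finsum_eq_sum_of_fintype] at this
    exact this
  have hι : 2 ≤ Fintype.card ι := Fintype.one_lt_card
  have hsum : ∑ i, Nat.card G * (2 * Nat.card (L ⊓ H i : Subgroup G) - 1) ≤
      2 * Nat.card L * ∑ i, (X i).ncard := by
    rw [Finset.mul_sum]
    exact Finset.sum_le_sum fun i _ ↦ hbound i
  have hsum' : ∑ i, (2 * Nat.card (L ⊓ H i : Subgroup G) - 1) =
      2 * ∑ i, (Nat.card (L ⊓ H i : Subgroup G) - 1) + Fintype.card ι := by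
    rw [Finset.mul_sum, ← Finset.card_univ, Finset.card_eq_sum_ones, ← Finset.sum_add_distrib]
    refine Finset.sum_congr rfl fun i _ ↦ ?_
    have : 0 < Nat.card (L ⊓ H i : Subgroup G) := Nat.card_pos
    lia
  rw [← Finset.mul_sum, hsum'] at hsum
  have hL0 : 0 < Nat.card L := Nat.card_pos
  have hG0 : 0 < Nat.card G := Nat.card_pos
  have h1 : 2 * Nat.card L ≤ 2 * S.ncard +
      (2 * ∑ i, (Nat.card (L ⊓ H i : Subgroup G) - 1) + Fintype.card ι) := by lia
  have h2 := Nat.mul_le_mul_left (Nat.card G) h1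
  have h3 := Nat.mul_le_mul_left (2 * Nat.card L) htotal
  nlinarith

theorem IsPerfectFocal.false {G : Type*} [Group G] [Finite G] [Nontrivial G]
    (hG : IsPerfectFocal G) : False := by
  obtain ⟨L, hL⟩ := hG.exists_isJunction
  have : Nontrivial {M // IsAttached L M} := by
    obtain ⟨M, N, hMN, hM, hN, -⟩ := hL
    exact ⟨⟨M, hM⟩, ⟨N, hN⟩, fun h ↦ hMN (congrArg Subtype.val h)⟩
  refine false_of_conj_disjoint (ι := {M // IsAttached L M}) (L := L) (M := fun M ↦ M)
    (H := fun M ↦ localHall M.1)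
    (S := {x | x ∈ L ∧ x ≠ 1 ∧ ∀ M : {M // IsAttached L M}, x ∉ localHall M.1})
    (fun _ ↦ Iff.rfl) (fun x hx y hy ↦ hG.commute_of_isJunction hL hx hy) ?_ ?_ ?_
    (fun M ↦ hG.card_mul_card_inf hL M.2) (fun M ↦ hG.two_mul_card_inf_le hL M.2)
    (fun M N hMN x hx hx1 g ↦
      hG.conj_notMem_localHall hL M.2 N.2 (Subtype.coe_ne_coe.2 hMN) hx hx1 g)
    (fun M s hs g ↦ hG.conj_notMem_localHall_of_forall hL M.2 hs.1 hs.2.1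
      (fun N hN ↦ hs.2.2 ⟨N, hN⟩) g)
  · intro s hs g hg
    refine hG.mem_of_forall_conj_mem hL fun x hx ↦
      hG.mem_of_commute hL hg.1 hg.2.1 (fun N hN ↦ hg.2.2 ⟨N, hN⟩) ?_
    exact (hG.commute_of_isJunction hL hx hs.1).map (MulAut.conj g)
  · intro M g hg x hx
    obtain ⟨p, hM⟩ := M.2.exists_isLocalPrime
    exact hG.conj_mem_localHall hM hg hx
  · intro M x hx hx1 g hg
    obtain ⟨p, hM⟩ := M.2.exists_isLocalPrime
    exact hG.mem_of_conj_mem_localHall hM hx hx1 hg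

/-- The order of a product of two commutators of coprime orders is the product of their orders. -/
def CommutatorOrdersMul (G : Type*) [Group G] : Prop :=
  ∀ a b : G, a ∈ commutatorSet G → b ∈ commutatorSet G → Nat.Coprime (orderOf a) (orderOf b) →
    orderOf (a * b) = orderOf a * orderOf b

theorem IsFocal.mem_commutatorSet {G : Type*} [Group G] {p : ℕ} {x : G} (hx : IsFocal p x) :
    x ∈ commutatorSet G := by
  obtain ⟨-, -, -, a, -, u, rfl⟩ := hx
  exact mem_commutatorSet_iff.2 ⟨a, u, rfl⟩

theorem coprime_orderOf_of_exists_pow_eq_one {G : Type*} [Group G] {p q : ℕ} (hp : p.Prime)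
    (hq : q.Prime) (hpq : p ≠ q) {x : G} (hx : ∃ k, x ^ p ^ k = 1) : (orderOf x).Coprime q := by
  obtain ⟨k, hk⟩ := hx
  exact Nat.Coprime.coprime_dvd_left (orderOf_dvd_of_pow_eq_one hk)
    (Nat.Coprime.pow_left k ((Nat.coprime_primes hp hq).2 hpq))

theorem exists_conj_pow_eq_one {G : Type*} [Group G] {p : ℕ} {x : G} (hx : ∃ k, x ^ p ^ k = 1)
    (g : G) : ∃ k, (g * x * g⁻¹) ^ p ^ k = 1 := by
  obtain ⟨k, hk⟩ := hx
  exact ⟨k, by rw [conj_pow, hk, mul_one, mul_inv_cancel]⟩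

section NilpotentSubgroup

variable {G : Type*} [Group G] {p : ℕ}

/-- A nilpotent subgroup `D` has a Sylow subgroup normalized by the normalizer of `D`. -/
theorem exists_isPGroup_of_isNilpotent [Finite G] {D : Subgroup G} (hD : Group.IsNilpotent D)
    (hp : p.Prime) :
    ∃ B : Subgroup G, IsPGroup p B ∧ B ≤ D ∧ (∀ x ∈ D, (∃ k, x ^ p ^ k = 1) → x ∈ B) ∧
      ∀ m ∈ normalizer (D : Set G), m ∈ normalizer (B : Set G) := by
  have : Fact p.Prime := ⟨hp⟩
  let Q : Sylow p D := default
  have hQ : (Q : Subgroup D).Normal := by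
    have h := (Group.isNilpotent_of_finite_tfae (G := D).out 0 3).1 hD
    exact h p ⟨hp⟩ Q
  have hBD : (Q : Subgroup D).map D.subtype ≤ D := map_subtype_le _
  have hmem : ∀ x ∈ D, (∃ k, x ^ p ^ k = 1) → x ∈ (Q : Subgroup D).map D.subtype := by
    rintro x hx ⟨k, hk⟩
    refine ⟨⟨x, hx⟩, Sylow.mem_of_mem_normalizer Q ⟨k, Subtype.ext hk⟩ ?_, rfl⟩
    rw [normalizer_eq_top]
    trivial
  have hB : IsPGroup p ((Q : Subgroup D).map D.subtype) := Q.isPGroup'.map _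
  refine ⟨_, hB, hBD, hmem, fun m hm ↦ mem_normalizer_of_conj_mem fun d hd ↦ ?_⟩
  exact hmem _ ((mem_normalizer_iff.1 hm d).1 (hBD hd))
    (exists_conj_pow_eq_one (IsPGroup.exists_pow_eq_one hB hd) m)

theorem isNilpotent_commutator_subgroup {M : Subgroup G} (hM : Group.IsNilpotent (commutator M)) :
    Group.IsNilpotent (⁅M, M⁆ : Subgroup G) := by
  rw [← map_subtype_commutator]
  exact Group.nilpotent_of_surjective _ (M.subtype.subgroupMap_surjective (commutator M))

end NilpotentSubgroup

namespace CommutatorOrdersMul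

variable {G : Type*} [Group G] {p : ℕ}

theorem subgroup (hG : CommutatorOrdersMul G) (M : Subgroup G) : CommutatorOrdersMul M := by
  have hM : ∀ a ∈ commutatorSet M, (a : G) ∈ commutatorSet G := by
    rintro a ⟨x, y, rfl⟩
    exact ⟨x, y, rfl⟩
  intro a b ha hb hab
  have := hG a b (hM a ha) (hM b hb) (by rwa [orderOf_coe, orderOf_coe])
  rwa [← coe_mul, orderOf_coe, orderOf_coe, orderOf_coe] at this

variable [Finite G]

theorem commute (hG : CommutatorOrdersMul G) {x b : G} {B : Subgroup G}
    (hx : x ∈ commutatorSet G) (hxp : (orderOf x).Coprime p) (hB : IsPGroup p B)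
    (hxB : x ∈ normalizer (B : Set G)) (hb : b ∈ B) : Commute x b := by
  have hc : ⁅x⁻¹, b⁻¹⁆ ∈ B := by
    have h1 := (mem_normalizer_iff.1 (inv_mem hxB) b⁻¹).1 (inv_mem hb)
    have h2 := mul_mem h1 hb
    simpa only [commutatorElement_def, mul_assoc, inv_inv] using h2
  obtain ⟨k, hk⟩ := IsPGroup.exists_pow_eq_one hB hc
  have hcop : (orderOf x).Coprime (orderOf ⁅x⁻¹, b⁻¹⁆) :=
    Nat.Coprime.coprime_dvd_right (orderOf_dvd_of_pow_eq_one hk) (hxp.pow_right k)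
  have h1 := hG x ⁅x⁻¹, b⁻¹⁆ hx (mem_commutatorSet_iff.2 ⟨_, _, rfl⟩) hcop
  have h2 : x * ⁅x⁻¹, b⁻¹⁆ = b⁻¹ * x * b⁻¹⁻¹ := by
    rw [commutatorElement_def]
    group
  rw [h2, orderOf_conj] at h1
  have h3 : orderOf ⁅x⁻¹, b⁻¹⁆ = 1 :=
    Nat.eq_of_mul_eq_mul_left (orderOf_pos x) (by rw [← h1, mul_one])
  rw [orderOf_eq_one_iff, commutatorElement_eq_one_iff_commute] at h3
  exact Commute.inv_inv_iff.1 h3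

theorem exists_core (hG : CommutatorOrdersMul G) {M : Subgroup G}
    (hM : Group.IsNilpotent (⁅M, M⁆ : Subgroup G)) (hp : p.Prime) {x : G} (hx : x ∈ M)
    (hf : IsFocal p x) :
    ∃ K : Subgroup G, IsPGroup p K ∧ K ≤ M ∧ M ≤ normalizer (K : Set G) ∧ x ∈ K := by
  have hDM : ⁅M, M⁆ ≤ M := commutator_le_self M
  have hMD : ∀ m ∈ M, m ∈ normalizer ((⁅M, M⁆ : Subgroup G) : Set G) := fun m hm ↦
    mem_normalizer_of_conj_mem fun d hd ↦ by
      have := mul_mem (commutator_mem_commutator hm (hDM hd)) hd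
      simpa [commutatorElement_def] using this
  obtain ⟨B, hB, hBD, hmem, hnorm⟩ := exists_isPGroup_of_isNilpotent hM hp
  have hxp := hf.exists_pow_eq_one
  have hK : IsPGroup p (zpowers x ⊔ B : Subgroup G) :=
    IsPGroup.to_sup_of_normal_right' (isPGroup_zpowers hxp) hB
      ((zpowers_le).2 (hnorm x (hMD x hx)))
  have hxK : x ∈ zpowers x ⊔ B := mem_sup_left (mem_zpowers x)
  refine ⟨_, hK, sup_le ((zpowers_le).2 hx) (hBD.trans hDM), fun m hm ↦ ?_, hxK⟩
  have hconj : m * x * m⁻¹ ∈ zpowers x ⊔ B := by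
    have hd : ⁅x⁻¹, m⁆ ∈ ⁅M, M⁆ := commutator_mem_commutator (inv_mem hx) hm
    have hxd : m * x * m⁻¹ = x * ⁅x⁻¹, m⁆ := by
      rw [commutatorElement_def]
      group
    generalize ⁅x⁻¹, m⁆ = d at hd hxd
    obtain ⟨i, j, hij, hi, hj⟩ := exists_pow_mul_pow_eq d hp
    have hw : x * d ^ i ∈ zpowers x ⊔ B :=
      mul_mem hxK (mem_sup_right (hmem _ (pow_mem hd i) hi))
    have hex : d ^ j ∈ centralizer {x} := by
      refine mem_of_forall_primary_pow_mem _ fun q hq hqd y hy hyq ↦ ?_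
      have hpq : p ≠ q := by
        rintro rfl
        exact hq.one_lt.ne' (Nat.Coprime.eq_one_of_dvd hj.symm hqd)
      obtain ⟨E, hE, -, hEmem, hEnorm⟩ := exists_isPGroup_of_isNilpotent hM hq
      have hyE : y ∈ E := hEmem y ((zpowers_le.2 (pow_mem hd j)) hy) hyq
      rw [mem_centralizer_singleton_iff]
      exact (hG.commute hf.mem_commutatorSet (coprime_orderOf_of_exists_pow_eq_one hp hq hpq hxp)
        hE (hEnorm x (hMD x hx)) hyE).symm.eq
    rw [mem_centralizer_singleton_iff] at hex
    have hcomm : Commute (x * d ^ i) (d ^ j) :=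
      (show Commute (d ^ j) x from hex).symm.mul_left (Commute.pow_pow_self d i j)
    obtain ⟨k, hk⟩ := IsPGroup.exists_pow_eq_one hK hw
    obtain ⟨l, hl⟩ := exists_conj_pow_eq_one hxp m
    have hwe : m * x * m⁻¹ = x * d ^ i * d ^ j := by rw [hxd, mul_assoc, ← hij]
    have he : d ^ j = 1 := by
      have h1 : (x * d ^ i * d ^ j) ^ (p ^ l * p ^ k) = 1 := by rw [← hwe, pow_mul, hl, one_pow]
      rw [hcomm.mul_pow, mul_comm (p ^ l), pow_mul, hk, one_pow, one_mul, ← pow_add] at h1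
      rw [← orderOf_eq_one_iff]
      exact Nat.Coprime.eq_one_of_dvd (hj.pow_right _) (orderOf_dvd_of_pow_eq_one h1)
    rw [hwe, he, mul_one]
    exact hw
  have hle : zpowers x ⊔ B ≤ (zpowers x ⊔ B).comap (MulAut.conj m).toMonoidHom := by
    refine sup_le ((zpowers_le).2 hconj) fun b hb ↦ ?_
    exact mem_sup_right ((mem_normalizer_iff.1 (hnorm m (hMD m hm)) b).1 hb)
  exact mem_normalizer_of_conj_mem fun d hd ↦ hle hd

/-- In a group that is not perfect, the derived subgroup is nilpotent if focal elements lie in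
normal `p`-subgroups of proper subgroups. -/
theorem _root_.HasFocalCores.isNilpotent_commutator (hF : HasFocalCores G)
    (hne : commutator G ≠ ⊤) : Group.IsNilpotent (commutator G) := by
  refine (Group.isNilpotent_of_finite_tfae.out 0 3).2 fun p hp P ↦ ?_
  have hle : ∀ P₁ P₂ : Sylow p (commutator G), (P₁ : Subgroup (commutator G)) ≤ P₂ := by
    intro P₁ P₂ c hc
    obtain ⟨R, hR⟩ := (P₁.isPGroup'.map (commutator G).subtype).exists_le_sylow
    have hcR : (c : G) ∈ commutator G ⊓ R := ⟨c.2, hR ⟨c, hc, rfl⟩⟩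
    have hcl : closure {x : G | x ∈ (R : Subgroup G) ∧ IsFocal p x} ≤
        (P₂ : Subgroup (commutator G)).map (commutator G).subtype := by
      rw [closure_le]
      rintro x ⟨-, hx⟩
      have hxC : x ∈ commutator G := by
        obtain ⟨-, -, -, a, -, u, rfl⟩ := hx
        exact commutator_mem_commutator (mem_top a) (mem_top u)
      obtain ⟨K, hK, hKC, hCK, hxK⟩ := hF _ hne p hp.out x hxC hx
      have hKn : (K.subgroupOf (commutator G)).Normal := normal_subgroupOf_of_le_normalizer hCK
      have hKp : IsPGroup p (K.subgroupOf (commutator G)) :=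
        hK.of_equiv (subgroupOfEquivOfLe hKC).symm
      exact ⟨⟨x, hxC⟩, hKp.le_sylow_of_normal P₂ hxK, rfl⟩
    obtain ⟨d, hd, hdc⟩ := hcl (commutator_inf_sylow_le hp.out R hcR)
    rwa [← Subtype.ext (a1 := d) (a2 := c) hdc]
  have : Subsingleton (Sylow p (commutator G)) :=
    ⟨fun P₁ P₂ ↦ Sylow.ext ((hle P₁ P₂).antisymm (hle P₂ P₁))⟩
  exact Sylow.normal_of_subsingleton P

theorem le_center (hG : CommutatorOrdersMul G) (hperf : commutator G = ⊤) (hp : p.Prime)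
    {N : Subgroup G} [N.Normal] (hN : IsPGroup p N) : N ≤ center G := by
  suffices hC : centralizer (N : Set G) = ⊤ by
    rwa [centralizer_eq_top_iff_subset] at hC
  by_contra hC
  have hq : ∀ {q : ℕ}, q.Prime → q ∣ (centralizer (N : Set G)).index → q = p := by
    intro q hq hqd
    by_contra hqp
    have : Fact q.Prime := ⟨hq⟩
    let Q : Sylow q G := default
    refine Q.not_dvd_index (hqd.trans (index_dvd_of_le ?_))
    have h1 := commutator_inf_sylow_le hq Q
    rw [hperf, top_inf_eq] at h1
    refine h1.trans ((closure_le _).2 ?_)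
    rintro x ⟨-, hx⟩
    refine mem_centralizer_iff.2 fun n hn ↦ ?_
    refine (hG.commute hx.mem_commutatorSet
      (coprime_orderOf_of_exists_pow_eq_one hq hp hqp hx.exists_pow_eq_one) hN ?_ hn).symm.eq
    rw [normalizer_eq_top]
    trivial
  have hcard := Nat.eq_prime_pow_of_unique_prime_dvd
    (n := (centralizer (N : Set G)).index) index_ne_zero_of_finite hq
  have : Fact p.Prime := ⟨hp⟩
  have hpq : IsPGroup p (G ⧸ centralizer (N : Set G)) := IsPGroup.of_card hcard
  have : Group.IsNilpotent (G ⧸ centralizer (N : Set G)) := hpq.isNilpotent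
  have : Nontrivial (G ⧸ centralizer (N : Set G)) := by
    rwa [QuotientGroup.nontrivial_iff]
  refine (Group.IsSolvable.commutator_lt_top_of_nontrivial (G ⧸ centralizer (N : Set G))).ne ?_
  have hmap := map_top_of_surjective _ (QuotientGroup.mk'_surjective (centralizer (N : Set G)))
  rw [commutator_def, ← hmap, ← map_commutator, ← commutator_def, hperf]

theorem _root_.exists_isPGroup_map_mk_eq (hp : p.Prime) {P : Subgroup (G ⧸ center G)}
    (hP : IsPGroup p P) :
    ∃ S : Subgroup G, IsPGroup p S ∧ S.map (QuotientGroup.mk' (center G)) = P ∧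
      ∀ x : G, (x : G ⧸ center G) ∈ P → (∃ k, x ^ p ^ k = 1) → x ∈ S := by
  have : Fact p.Prime := ⟨hp⟩
  have hPn : Group.IsNilpotent P := hP.isNilpotent
  have hT : Group.IsNilpotent (P.comap (QuotientGroup.mk' (center G))) := by
    refine Subgroup.isNilpotent_of_ker_le_center ((QuotientGroup.mk' (center G)).subgroupComap P) ?_
    intro x hx
    have hx1 : QuotientGroup.mk' (center G) x = 1 := congrArg Subtype.val (MonoidHom.mem_ker.1 hx)
    have hx2 : (x : G) ∈ center G := (QuotientGroup.eq_one_iff _).1 hx1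
    exact mem_center_iff.2 fun y ↦ Subtype.ext (mem_center_iff.1 hx2 y)
  obtain ⟨S, hS, hST, hmem, -⟩ := exists_isPGroup_of_isNilpotent hT hp
  refine ⟨S, hS, le_antisymm (map_le_iff_le_comap.2 hST) fun y hy ↦ ?_, fun x hx ↦ hmem x hx⟩
  obtain ⟨g, rfl⟩ := QuotientGroup.mk'_surjective _ y
  obtain ⟨i, j, hij, hi, hj⟩ := exists_pow_mul_pow_eq g hp
  have hgi : g ^ i ∈ S := hmem _ (pow_mem (show g ∈ P.comap _ from hy) i) hi
  have hj1 : QuotientGroup.mk' (center G) (g ^ j) = 1 := by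
    have hjP : QuotientGroup.mk' (center G) (g ^ j) ∈ P := by
      rw [map_pow]
      exact pow_mem hy j
    obtain ⟨k, hk⟩ := IsPGroup.exists_pow_eq_one hP hjP
    rw [← orderOf_eq_one_iff]
    exact Nat.eq_one_of_dvd_coprimes (hj.pow_right k) (orderOf_map_dvd _ _)
      (orderOf_dvd_of_pow_eq_one hk)
  refine ⟨g ^ i, hgi, ?_⟩
  conv_rhs => rw [hij, map_mul, hj1, mul_one]

theorem _root_.HasFocalCores.quotient_center (hF : HasFocalCores G) :
    HasFocalCores (G ⧸ center G) := by
  intro M hM p hp x hx hf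
  obtain ⟨P, hP, hxP, a', ha', u', rfl⟩ := hf
  obtain ⟨S, hS, rfl, hmem⟩ := exists_isPGroup_map_mk_eq hp hP
  obtain ⟨a, ha, rfl⟩ := ha'
  obtain ⟨u, rfl⟩ := QuotientGroup.mk'_surjective _ u'
  have hu : u * a⁻¹ * u⁻¹ ∈ S := by
    refine hmem _ ?_ (exists_conj_pow_eq_one (IsPGroup.exists_pow_eq_one hS (inv_mem ha)) u)
    have h1 := mul_mem (inv_mem (mem_map_of_mem (QuotientGroup.mk' (center G)) ha)) hxP
    have h2 : QuotientGroup.mk' (center G) (u * a⁻¹ * u⁻¹) ∈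
        S.map (QuotientGroup.mk' (center G)) := by
      simpa [commutatorElement_def, mul_assoc] using h1
    exact h2
  have hxS : ⁅a, u⁆ ∈ S := by
    have := mul_mem ha hu
    simpa only [commutatorElement_def, mul_assoc] using this
  have hne : M.comap (QuotientGroup.mk' (center G)) ≠ ⊤ := by
    intro h
    refine hM (eq_top_iff.2 fun y _ ↦ ?_)
    obtain ⟨g, rfl⟩ := QuotientGroup.mk'_surjective _ y
    exact (h ▸ mem_top g : g ∈ M.comap (QuotientGroup.mk' (center G)))
  rw [← map_commutatorElement] at hx ⊢
  obtain ⟨K, hK, hKM, hMK, hxK⟩ := hF _ hne p hp ⁅a, u⁆ hx ⟨S, hS, hxS, a, ha, u, rfl⟩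
  refine ⟨K.map (QuotientGroup.mk' (center G)), hK.map _, map_le_iff_le_comap.2 hKM, ?_,
    mem_map_of_mem _ hxK⟩
  intro m hm
  obtain ⟨m, rfl⟩ := QuotientGroup.mk'_surjective _ m
  refine mem_normalizer_of_conj_mem ?_
  rintro _ ⟨d, hd, rfl⟩
  refine ⟨m * d * m⁻¹, (mem_normalizer_iff.1 (hMK hm) d).1 hd, ?_⟩
  rw [map_mul, map_mul, map_inv]

theorem center_eq_top (hG : CommutatorOrdersMul G) (hF : HasFocalCores G)
    (hperf : commutator G = ⊤) : center G = ⊤ := by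
  by_contra hne
  have : Nontrivial (G ⧸ center G) := by
    rwa [QuotientGroup.nontrivial_iff]
  refine IsPerfectFocal.false (G := G ⧸ center G) ⟨hF.quotient_center, ?_, ?_⟩
  · have hmap := map_top_of_surjective _ (QuotientGroup.mk'_surjective (center G))
    rw [commutator_def, ← hmap, ← map_commutator, ← commutator_def, hperf]
  · intro p hp N hN hNp
    obtain ⟨S, hS, rfl, hmem⟩ := exists_isPGroup_map_mk_eq hp hNp
    have hSn : S.Normal := by
      refine ⟨fun s hs g ↦ hmem _ ?_
        (exists_conj_pow_eq_one (IsPGroup.exists_pow_eq_one hS hs) g)⟩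
      exact hN.conj_mem _ (mem_map_of_mem (QuotientGroup.mk' (center G)) hs) g
    rw [eq_bot_iff, map_le_iff_le_comap, MonoidHom.comap_bot, QuotientGroup.ker_mk']
    exact hG.le_center hperf hp hS

end CommutatorOrdersMul

theorem CommutatorOrdersMul.isNilpotent_commutator.{u} (n : ℕ) :
    ∀ (G : Type u) [Group G] [Finite G], Nat.card G = n → CommutatorOrdersMul G →
      Group.IsNilpotent (commutator G) := by
  induction n using Nat.strong_induction_on with
  | _ n ih =>
    intro G _ _ hn hG
    have hF : HasFocalCores G := by
      intro M hM p hp x hx hf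
      have hlt : Nat.card M < n := by
        rw [← hn]
        exact (card_le_card_group M).lt_of_ne fun h ↦ hM (eq_top_of_card_eq M h)
      exact hG.exists_core (isNilpotent_commutator_subgroup (ih _ hlt M rfl (hG.subgroup M)))
        hp hx hf
    by_cases hperf : commutator G = ⊤
    · have hZ := hG.center_eq_top hF hperf
      have hbot : commutator G = ⊥ := by
        rw [eq_bot_iff, commutator_def, commutator_le]
        intro a _ b _
        rw [mem_bot, commutatorElement_eq_one_iff_mul_comm]
        exact mem_center_iff.1 (hZ ▸ mem_top b) a
      rw [hbot]
      infer_instance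
    · exact hF.isNilpotent_commutator hperf

end Preliminaries

theorem bastos_shumyatsky (G : Type*) [Group G] [Finite G]
    (h : ∀ a b : G, a ∈ commutatorSet G → b ∈ commutatorSet G →
      Nat.Coprime (orderOf a) (orderOf b) →
      orderOf (a * b) = orderOf a * orderOf b) :
    Group.IsNilpotent (commutator G) :=
  CommutatorOrdersMul.isNilpotent_commutator _ G rfl h
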